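/- arXiv:1906.03290 — 5 statements merged into one kernel-verified Lean document; each statement's English description precedes it below -/
import Mathlib

section
/- The bimodule T_λ = 𝕎_λ ⊗_{𝔸_λ} 𝕎_λ^o is a cyclic 𝔤[t]×𝔤[t]-bimodule generated by w̄_λ = w_λ ⊗ w_λ^o with defining relations: 𝔫₊[t]·w̄_λ = 0; w̄_λ·𝔫₋[t] = 0; (h⊗1)·w̄_λ = w̄_λ·(h⊗1) = λ(h)·w̄_λ for h ∈ 𝔥; f_{−α}^{⟨λ,α^∨⟩+1}·w̄_λ = 0 and w̄_λ·e_α^{⟨λ,α^∨⟩+1} = 0 for every positive root α; and (h⊗t^k)·w̄_λ = w̄_λ·(h⊗t^k) for all h ∈ 𝔥 and k ≥ 0. -/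
/-
Common setup: a simple finite-dimensional complex Lie algebra `g` with a triangular
decomposition `g = n₋ ⊕ h ⊕ n₊`, its current algebra `g[t] = ℂ[t] ⊗ g`, and
(left and right, global and local) Weyl modules over `g[t]`, presented by their
defining generators and relations (cyclicity + relations + universal property).
-/

open scoped TensorProduct
open Polynomial

noncomputable section

/-- The current Lie algebra `𝔤[t] = ℂ[t] ⊗ 𝔤`. -/
abbrev Cur (g : Type) [LieRing g] [LieAlgebra ℂ g] := Polynomial ℂ ⊗[ℂ] g

instance (g : Type) [LieRing g] [LieAlgebra ℂ g] : LieAlgebra ℂ (Cur g) where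
  lie_smul c x y := by
    have h := lie_smul (R := Polynomial ℂ) ((algebraMap ℂ (Polynomial ℂ)) c) x y
    rw [algebraMap_smul, algebraMap_smul] at h
    exact h

variable (g : Type) [LieRing g] [LieAlgebra ℂ g]

/-- Data of a triangular decomposition `𝔤 = 𝔫₋ ⊕ 𝔥 ⊕ 𝔫₊` of a simple Lie algebra `𝔤`,
together with the root vectors `e_α`, `f_{-α}` (α a positive root), the partially ordered
set `P₊` of dominant integral weights (`λ ≥ μ` iff `λ - μ` is a nonnegative integral
combination of simple roots), the pairings `⟨λ, α^∨⟩ ∈ ℕ` and the values `λ(h)`, `h ∈ 𝔥`. -/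
structure TriData where
  /-- the set `P₊` of dominant integral weights -/
  P : Type
  /-- the standard partial order on dominant weights -/
  [ord : PartialOrder P]
  /-- the set `Δ₊` of positive roots -/
  Δ : Type
  /-- the Cartan subalgebra -/
  H : LieSubalgebra ℂ g
  /-- the positive nilpotent subalgebra -/
  nP : LieSubalgebra ℂ g
  /-- the negative nilpotent subalgebra -/
  nM : LieSubalgebra ℂ g
  /-- positive root vectors -/
  e : Δ → g
  /-- negative root vectors -/
  f : Δ → g
  e_mem : ∀ α, e α ∈ nP
  f_mem : ∀ α, f α ∈ nM
  triangular : (nM : Submodule ℂ g) ⊔ (H : Submodule ℂ g) ⊔ (nP : Submodule ℂ g) = ⊤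
  /-- `⟨λ, α^∨⟩` -/
  pair : P → Δ → ℕ
  /-- `λ(h)` for `h ∈ 𝔥` -/
  wt : P → (H →ₗ[ℂ] ℂ)

attribute [instance] TriData.ord

variable {g}

/-- The (left) global Weyl module `𝕎_λ`: a cyclic `𝔤[t]`-module with cyclic vector `w_λ`
of `𝔥`-weight `λ`, defined by the relations `𝔫₊[t]·w_λ = 0`,
`(f_{-α} ⊗ 1)^{⟨λ,α^∨⟩+1} w_λ = 0`; the universal property expresses that these
relations are defining. -/
structure GlobalWeyl (D : TriData g) (lam : D.P) where
  M : Type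
  [acg : AddCommGroup M]
  [mods : Module ℂ M]
  [lrm : LieRingModule (Cur g) M]
  [lm : LieModule ℂ (Cur g) M]
  w : M
  rel_n : ∀ (p : Polynomial ℂ) (x : g), x ∈ D.nP → ⁅p ⊗ₜ[ℂ] x, w⁆ = 0
  rel_h : ∀ x : D.H, ⁅(1 : Polynomial ℂ) ⊗ₜ[ℂ] (x : g), w⁆ = D.wt lam x • w
  rel_f : ∀ α : D.Δ,
    ((LieModule.toEnd ℂ (Cur g) M ((1 : Polynomial ℂ) ⊗ₜ[ℂ] D.f α)) ^ (D.pair lam α + 1)) w = 0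
  cyclic : ∀ N : LieSubmodule ℂ (Cur g) M, w ∈ N → N = ⊤
  universal : ∀ (N : Type) [AddCommGroup N] [Module ℂ N] [LieRingModule (Cur g) N]
    [LieModule ℂ (Cur g) N] (v : N),
    (∀ (p : Polynomial ℂ) (x : g), x ∈ D.nP → ⁅p ⊗ₜ[ℂ] x, v⁆ = 0) →
    (∀ x : D.H, ⁅(1 : Polynomial ℂ) ⊗ₜ[ℂ] (x : g), v⁆ = D.wt lam x • v) →
    (∀ α : D.Δ,
      ((LieModule.toEnd ℂ (Cur g) N ((1 : Polynomial ℂ) ⊗ₜ[ℂ] D.f α)) ^ (D.pair lam α + 1)) v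
        = 0) →
    ∃ φ : M →ₗ⁅ℂ,Cur g⁆ N, φ w = v

attribute [instance] GlobalWeyl.acg GlobalWeyl.mods GlobalWeyl.lrm GlobalWeyl.lm

/-- The (left) local Weyl module `W_λ`: the quotient of `𝕎_λ` by the extra relations
`(𝔥 ⊗ tℂ[t])·w_λ = 0`; again presented by generators and relations. -/
structure LocalWeyl (D : TriData g) (lam : D.P) where
  M : Type
  [acg : AddCommGroup M]
  [mods : Module ℂ M]
  [lrm : LieRingModule (Cur g) M]
  [lm : LieModule ℂ (Cur g) M]
  w : M
  rel_n : ∀ (p : Polynomial ℂ) (x : g), x ∈ D.nP → ⁅p ⊗ₜ[ℂ] x, w⁆ = 0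
  rel_h : ∀ x : D.H, ⁅(1 : Polynomial ℂ) ⊗ₜ[ℂ] (x : g), w⁆ = D.wt lam x • w
  rel_ht : ∀ (q : Polynomial ℂ) (x : D.H), ⁅(X * q) ⊗ₜ[ℂ] (x : g), w⁆ = 0
  rel_f : ∀ α : D.Δ,
    ((LieModule.toEnd ℂ (Cur g) M ((1 : Polynomial ℂ) ⊗ₜ[ℂ] D.f α)) ^ (D.pair lam α + 1)) w = 0
  cyclic : ∀ N : LieSubmodule ℂ (Cur g) M, w ∈ N → N = ⊤
  universal : ∀ (N : Type) [AddCommGroup N] [Module ℂ N] [LieRingModule (Cur g) N]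
    [LieModule ℂ (Cur g) N] (v : N),
    (∀ (p : Polynomial ℂ) (x : g), x ∈ D.nP → ⁅p ⊗ₜ[ℂ] x, v⁆ = 0) →
    (∀ x : D.H, ⁅(1 : Polynomial ℂ) ⊗ₜ[ℂ] (x : g), v⁆ = D.wt lam x • v) →
    (∀ (q : Polynomial ℂ) (x : D.H), ⁅(X * q) ⊗ₜ[ℂ] (x : g), v⁆ = 0) →
    (∀ α : D.Δ,
      ((LieModule.toEnd ℂ (Cur g) N ((1 : Polynomial ℂ) ⊗ₜ[ℂ] D.f α)) ^ (D.pair lam α + 1)) v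
        = 0) →
    ∃ φ : M →ₗ⁅ℂ,Cur g⁆ N, φ w = v

attribute [instance] LocalWeyl.acg LocalWeyl.mods LocalWeyl.lrm LocalWeyl.lm

variable (g)

/-- A right module over a Lie algebra `L`: a bilinear action `ρ` with
`m·[x,y] = (m·x)·y - (m·y)·x`. -/
structure RightLieAction (L : Type) [LieRing L] [LieAlgebra ℂ L]
    (M : Type) [AddCommGroup M] [Module ℂ M] where
  ρ : M →ₗ[ℂ] L →ₗ[ℂ] M
  ρ_lie : ∀ (m : M) (x y : L), ρ m ⁅x, y⁆ = ρ (ρ m x) y - ρ (ρ m y) x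

variable {g}

/-- The right global Weyl module `𝕎_λ^o`: a cyclic right `𝔤[t]`-module with cyclic
vector `w_λ^o` of weight `λ`, defined by the relations `w_λ^o·𝔫₋[t] = 0` and
`w_λ^o·(e_α ⊗ 1)^{⟨λ,α^∨⟩+1} = 0`. -/
structure RightGlobalWeyl (D : TriData g) (lam : D.P) where
  M : Type
  [acg : AddCommGroup M]
  [mods : Module ℂ M]
  act : RightLieAction (Cur g) M
  w : M
  rel_n : ∀ (p : Polynomial ℂ) (x : g), x ∈ D.nM → act.ρ w (p ⊗ₜ[ℂ] x) = 0
  rel_h : ∀ x : D.H, act.ρ w ((1 : Polynomial ℂ) ⊗ₜ[ℂ] (x : g)) = D.wt lam x • w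
  rel_e : ∀ α : D.Δ,
    ((fun m => act.ρ m ((1 : Polynomial ℂ) ⊗ₜ[ℂ] D.e α))^[D.pair lam α + 1]) w = 0
  cyclic : ∀ S : Submodule ℂ M, w ∈ S → (∀ m ∈ S, ∀ x : Cur g, act.ρ m x ∈ S) → S = ⊤
  universal : ∀ (N : Type) [AddCommGroup N] [Module ℂ N] (a : RightLieAction (Cur g) N)
    (v : N),
    (∀ (p : Polynomial ℂ) (x : g), x ∈ D.nM → a.ρ v (p ⊗ₜ[ℂ] x) = 0) →
    (∀ x : D.H, a.ρ v ((1 : Polynomial ℂ) ⊗ₜ[ℂ] (x : g)) = D.wt lam x • v) →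
    (∀ α : D.Δ,
      ((fun m => a.ρ m ((1 : Polynomial ℂ) ⊗ₜ[ℂ] D.e α))^[D.pair lam α + 1]) v = 0) →
    ∃ φ : M →ₗ[ℂ] N, φ w = v ∧ ∀ (m : M) (x : Cur g), φ (act.ρ m x) = a.ρ (φ m) x

attribute [instance] RightGlobalWeyl.acg RightGlobalWeyl.mods

/-- The right local Weyl module `W_λ^o`: as `𝕎_λ^o` with the additional relations
`w_λ^o·(𝔥 ⊗ tℂ[t]) = 0`. -/
structure RightLocalWeyl (D : TriData g) (lam : D.P) where
  M : Type
  [acg : AddCommGroup M]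
  [mods : Module ℂ M]
  act : RightLieAction (Cur g) M
  w : M
  rel_n : ∀ (p : Polynomial ℂ) (x : g), x ∈ D.nM → act.ρ w (p ⊗ₜ[ℂ] x) = 0
  rel_h : ∀ x : D.H, act.ρ w ((1 : Polynomial ℂ) ⊗ₜ[ℂ] (x : g)) = D.wt lam x • w
  rel_ht : ∀ (q : Polynomial ℂ) (x : D.H), act.ρ w ((X * q) ⊗ₜ[ℂ] (x : g)) = 0
  rel_e : ∀ α : D.Δ,
    ((fun m => act.ρ m ((1 : Polynomial ℂ) ⊗ₜ[ℂ] D.e α))^[D.pair lam α + 1]) w = 0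
  cyclic : ∀ S : Submodule ℂ M, w ∈ S → (∀ m ∈ S, ∀ x : Cur g, act.ρ m x ∈ S) → S = ⊤
  universal : ∀ (N : Type) [AddCommGroup N] [Module ℂ N] (a : RightLieAction (Cur g) N)
    (v : N),
    (∀ (p : Polynomial ℂ) (x : g), x ∈ D.nM → a.ρ v (p ⊗ₜ[ℂ] x) = 0) →
    (∀ x : D.H, a.ρ v ((1 : Polynomial ℂ) ⊗ₜ[ℂ] (x : g)) = D.wt lam x • v) →
    (∀ (q : Polynomial ℂ) (x : D.H), a.ρ v ((X * q) ⊗ₜ[ℂ] (x : g)) = 0) →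
    (∀ α : D.Δ,
      ((fun m => a.ρ m ((1 : Polynomial ℂ) ⊗ₜ[ℂ] D.e α))^[D.pair lam α + 1]) v = 0) →
    ∃ φ : M →ₗ[ℂ] N, φ w = v ∧ ∀ (m : M) (x : Cur g), φ (act.ρ m x) = a.ρ (φ m) x

attribute [instance] RightLocalWeyl.acg RightLocalWeyl.mods

/-- The highest weight algebra `𝔸_λ` (see the paper), acting on `𝕎_λ` and `𝕎_λ^o`
commuting with the `𝔤[t]`-actions; `θ h k` is the image of `h ⊗ t^{k+1}`. -/
structure HWData (D : TriData g) (lam : D.P)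
    (Wl : GlobalWeyl D lam) (Wo : RightGlobalWeyl D lam) where
  A : Type
  [cr : CommRing A]
  [alg : Algebra ℂ A]
  [modL : Module A Wl.M]
  [towL : IsScalarTower ℂ A Wl.M]
  [modR : Module A Wo.M]
  [towR : IsScalarTower ℂ A Wo.M]
  θ : D.H → ℕ → A
  gen : Algebra.adjoin ℂ {a : A | ∃ h k, a = θ h k} = ⊤
  theta_w : ∀ (h : D.H) (k : ℕ),
    θ h k • Wl.w = ⁅(X ^ (k + 1) : Polynomial ℂ) ⊗ₜ[ℂ] (h : g), Wl.w⁆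
  faithful_w : ∀ a : A, a • Wl.w = 0 → a = 0
  commL : ∀ (a : A) (x : Cur g) (m : Wl.M), a • ⁅x, m⁆ = ⁅x, a • m⁆
  theta_wo : ∀ (h : D.H) (k : ℕ),
    θ h k • Wo.w = Wo.act.ρ Wo.w ((X ^ (k + 1) : Polynomial ℂ) ⊗ₜ[ℂ] (h : g))
  commR : ∀ (a : A) (x : Cur g) (m : Wo.M), a • (Wo.act.ρ m x) = Wo.act.ρ (a • m) x

attribute [instance] HWData.cr HWData.alg HWData.modL HWData.towL HWData.modR HWData.towR

variable {D : TriData g} {lam : D.P} {Wl : GlobalWeyl D lam} {Wo : RightGlobalWeyl D lam}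

/-- The left `𝔤[t]`-action on `𝕎_λ` is `𝔸_λ`-linear. -/
def bracketA (Hd : HWData D lam Wl Wo) (x : Cur g) : Wl.M →ₗ[Hd.A] Wl.M where
  toFun m := ⁅x, m⁆
  map_add' a b := lie_add x a b
  map_smul' a m := (Hd.commL a x m).symm

/-- The right `𝔤[t]`-action on `𝕎_λ^o` is `𝔸_λ`-linear. -/
def rhoA (Hd : HWData D lam Wl Wo) (x : Cur g) : Wo.M →ₗ[Hd.A] Wo.M where
  toFun m := Wo.act.ρ m x
  map_add' a b := by simp
  map_smul' a m := (Hd.commR a x m).symm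

/-- `T_λ = 𝕎_λ ⊗_{𝔸_λ} 𝕎_λ^o`. -/
abbrev Tmod (Hd : HWData D lam Wl Wo) := TensorProduct Hd.A Wl.M Wo.M


/-- An abstract `𝔤[t] × 𝔤[t]`-bimodule: a left `𝔤[t]`-module with a commuting right
`𝔤[t]`-action. -/
structure CurBimod (g : Type) [LieRing g] [LieAlgebra ℂ g] where
  N : Type
  [acg : AddCommGroup N]
  [mods : Module ℂ N]
  [lrm : LieRingModule (Cur g) N]
  [lm : LieModule ℂ (Cur g) N]
  act : RightLieAction (Cur g) N
  compat : ∀ (x y : Cur g) (n : N), ⁅x, act.ρ n y⁆ = act.ρ ⁅x, n⁆ y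

attribute [instance] CurBimod.acg CurBimod.mods CurBimod.lrm CurBimod.lm

/-- The left action of `𝔤[t]` on `T_λ = 𝕎_λ ⊗_{𝔸_λ} 𝕎_λ^o` (through the first factor). -/
def ltop (Hd : HWData D lam Wl Wo) (x : Cur g) : Tmod Hd →ₗ[Hd.A] Tmod Hd :=
  TensorProduct.map (bracketA Hd x) LinearMap.id

/-- The right action of `𝔤[t]` on `T_λ = 𝕎_λ ⊗_{𝔸_λ} 𝕎_λ^o` (through the second factor). -/
def rtop (Hd : HWData D lam Wl Wo) (x : Cur g) : Tmod Hd →ₗ[Hd.A] Tmod Hd :=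
  TensorProduct.map LinearMap.id (rhoA Hd x)

theorem GlobalWeyl.induction (W : GlobalWeyl D lam) {p : W.M → Prop} (hw : p W.w)
    (hadd : ∀ a b, p a → p b → p (a + b)) (hsmul : ∀ (c : ℂ) a, p a → p (c • a))
    (hlie : ∀ (x : Cur g) a, p a → p ⁅x, a⁆) (m : W.M) : p m := by
  let N : LieSubmodule ℂ (Cur g) W.M :=
    { carrier := {m | p m}
      add_mem' := fun {a b} ha hb => hadd a b ha hb
      zero_mem' := by simpa using hsmul 0 _ hw
      smul_mem' := fun c a ha => hsmul c a ha
      lie_mem := fun {x a} ha => hlie x a ha }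
  have hm : m ∈ N := W.cyclic N hw ▸ LieSubmodule.mem_top m
  exact hm

theorem RightGlobalWeyl.induction (W : RightGlobalWeyl D lam) {p : W.M → Prop} (hw : p W.w)
    (hadd : ∀ a b, p a → p b → p (a + b)) (hsmul : ∀ (c : ℂ) a, p a → p (c • a))
    (hact : ∀ (x : Cur g) a, p a → p (W.act.ρ a x)) (m : W.M) : p m := by
  let S : Submodule ℂ W.M :=
    { carrier := {m | p m}
      add_mem' := fun {a b} ha hb => hadd a b ha hb
      zero_mem' := by simpa using hsmul 0 _ hw
      smul_mem' := fun c a ha => hsmul c a ha }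
  have hm : m ∈ S := W.cyclic S hw (fun a ha x => hact x a ha) ▸ Submodule.mem_top
  exact hm

/-- Equivariant maps out of a right global Weyl module are determined by the image of the
cyclic vector. -/
theorem RightGlobalWeyl.hom_ext (W : RightGlobalWeyl D lam) {N : Type} [AddCommGroup N]
    [Module ℂ N] (a : RightLieAction (Cur g) N) {φ ψ : W.M →ₗ[ℂ] N}
    (hφ : ∀ m x, φ (W.act.ρ m x) = a.ρ (φ m) x) (hψ : ∀ m x, ψ (W.act.ρ m x) = a.ρ (ψ m) x)
    (h : φ W.w = ψ W.w) : φ = ψ := by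
  ext m
  induction m using W.induction with
  | hw => exact h
  | hadd a b ha hb => rw [map_add, map_add, ha, hb]
  | hsmul c a ha => rw [map_smul, map_smul, ha]
  | hact x a ha => rw [hφ, hψ, ha]

@[simp]
theorem ltop_tmul (Hd : HWData D lam Wl Wo) (x : Cur g) (m : Wl.M) (n : Wo.M) :
    ltop Hd x (m ⊗ₜ[Hd.A] n) = ⁅x, m⁆ ⊗ₜ[Hd.A] n := rfl

@[simp]
theorem rtop_tmul (Hd : HWData D lam Wl Wo) (x : Cur g) (m : Wl.M) (n : Wo.M) :
    rtop Hd x (m ⊗ₜ[Hd.A] n) = m ⊗ₜ[Hd.A] Wo.act.ρ n x := rfl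

theorem ltop_pow_tmul (Hd : HWData D lam Wl Wo) (x : Cur g) (k : ℕ) (m : Wl.M) (n : Wo.M) :
    (ltop Hd x ^ k) (m ⊗ₜ[Hd.A] n) =
      ((LieModule.toEnd ℂ (Cur g) Wl.M x ^ k) m) ⊗ₜ[Hd.A] n := by
  induction k generalizing m with
  | zero => rfl
  | succ k ih => rw [pow_succ, pow_succ, Module.End.mul_apply, ltop_tmul, ih]; rfl

theorem rtop_pow_tmul (Hd : HWData D lam Wl Wo) (x : Cur g) (k : ℕ) (m : Wl.M) (n : Wo.M) :
    (rtop Hd x ^ k) (m ⊗ₜ[Hd.A] n) =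
      m ⊗ₜ[Hd.A] ((fun n => Wo.act.ρ n x)^[k] n) := by
  induction k generalizing n with
  | zero => rfl
  | succ k ih => rw [pow_succ, Module.End.mul_apply, rtop_tmul, ih]; rfl

theorem tmul_smul_complex (Hd : HWData D lam Wl Wo) (c : ℂ) (m : Wl.M) (n : Wo.M) :
    m ⊗ₜ[Hd.A] (c • n) = c • (m ⊗ₜ[Hd.A] n) := by
  rw [← algebraMap_smul Hd.A c n, TensorProduct.tmul_smul, TensorProduct.smul_tmul',
    algebraMap_smul, TensorProduct.smul_tmul']

/-- The relations of a right global Weyl module at `v` pass to every vector of the left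
submodule generated by `v`, giving a biequivariant pairing `𝕎_λ × 𝕎_λ^o → B`. -/
theorem exists_biequivariant_pairing (Wl : GlobalWeyl D lam) (Wo : RightGlobalWeyl D lam)
    (B : CurBimod g) (v : B.N)
    (hnP : ∀ (p : Polynomial ℂ) (x : g), x ∈ D.nP → ⁅p ⊗ₜ[ℂ] x, v⁆ = 0)
    (hnM : ∀ (p : Polynomial ℂ) (x : g), x ∈ D.nM → B.act.ρ v (p ⊗ₜ[ℂ] x) = 0)
    (hl : ∀ h : D.H, ⁅(1 : Polynomial ℂ) ⊗ₜ[ℂ] (h : g), v⁆ = D.wt lam h • v)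
    (hr : ∀ h : D.H, B.act.ρ v ((1 : Polynomial ℂ) ⊗ₜ[ℂ] (h : g)) = D.wt lam h • v)
    (hf : ∀ α : D.Δ, ((LieModule.toEnd ℂ (Cur g) B.N ((1 : Polynomial ℂ) ⊗ₜ[ℂ] D.f α)) ^
      (D.pair lam α + 1)) v = 0)
    (he : ∀ α : D.Δ, ((fun n => B.act.ρ n ((1 : Polynomial ℂ) ⊗ₜ[ℂ] D.e α))^[
      D.pair lam α + 1]) v = 0) :
    ∃ F : Wl.M →ₗ[ℂ] Wo.M →ₗ[ℂ] B.N, F Wl.w Wo.w = v ∧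
      (∀ (x : Cur g) m n, F ⁅x, m⁆ n = ⁅x, F m n⁆) ∧
      (∀ (x : Cur g) m n, F m (Wo.act.ρ n x) = B.act.ρ (F m n) x) := by
  obtain ⟨ψ, hψ⟩ := Wl.universal B.N v hnP hl hf
  have iter_flip (y : Cur g) (k : ℕ) (u : B.N) :
      (fun n => B.act.ρ n y)^[k] u = (B.act.ρ.flip y ^ k) u := by
    rw [Module.End.pow_apply]; rfl
  have comm (x y : Cur g) (k : ℕ) (u : B.N) :
      (B.act.ρ.flip y ^ k) ⁅x, u⁆ = ⁅x, (B.act.ρ.flip y ^ k) u⁆ := by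
    induction k generalizing u with
    | zero => rfl
    | succ k ih =>
      rw [pow_succ, Module.End.mul_apply, Module.End.mul_apply, LinearMap.flip_apply,
        LinearMap.flip_apply, ← B.compat, ih]
  have key (m : Wl.M) : ∃ φ : Wo.M →ₗ[ℂ] B.N, φ Wo.w = ψ m ∧
      ∀ n x, φ (Wo.act.ρ n x) = B.act.ρ (φ n) x := by
    refine Wo.universal B.N B.act (ψ m) (fun p x hx => ?_) (fun h => ?_) (fun α => ?_)
    · induction m using Wl.induction with
      | hw => rw [hψ, hnM p x hx]
      | hadd a b ha hb => rw [map_add, map_add, LinearMap.add_apply, ha, hb, add_zero]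
      | hsmul c a ha => rw [map_smul, map_smul, LinearMap.smul_apply, ha, smul_zero]
      | hlie y a ha => rw [LieModuleHom.map_lie, ← B.compat, ha, lie_zero]
    · induction m using Wl.induction with
      | hw => rw [hψ, hr h]
      | hadd a b ha hb => rw [map_add, map_add, LinearMap.add_apply, ha, hb, smul_add]
      | hsmul c a ha => rw [map_smul, map_smul, LinearMap.smul_apply, ha, smul_comm]
      | hlie y a ha => rw [LieModuleHom.map_lie, ← B.compat, ha, lie_smul]
    · rw [iter_flip]
      induction m using Wl.induction with
      | hw => rw [hψ, ← iter_flip, he α]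
      | hadd a b ha hb => rw [map_add, map_add, ha, hb, add_zero]
      | hsmul c a ha => rw [map_smul, map_smul, ha, smul_zero]
      | hlie y a ha => rw [LieModuleHom.map_lie, comm, ha, lie_zero]
  choose Φ hΦw hΦ using key
  let F : Wl.M →ₗ[ℂ] Wo.M →ₗ[ℂ] B.N :=
    { toFun := Φ
      map_add' := fun a b => Wo.hom_ext B.act (hΦ _)
        (fun m x => by simp only [LinearMap.add_apply, hΦ, map_add])
        (by simp only [LinearMap.add_apply, hΦw, map_add])
      map_smul' := fun c a => Wo.hom_ext B.act (hΦ _)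
        (fun m x => by simp only [RingHom.id_apply, LinearMap.smul_apply, hΦ, map_smul])
        (by simp only [RingHom.id_apply, LinearMap.smul_apply, hΦw, map_smul]) }
  refine ⟨F, (hΦw _).trans hψ, fun x m n => ?_, fun x m n => hΦ m n x⟩
  have h : Φ ⁅x, m⁆ = (LieModule.toEnd ℂ (Cur g) B.N x).comp (Φ m) :=
    Wo.hom_ext B.act (hΦ _)
      (fun n y => by
        simp only [LinearMap.comp_apply, LieModule.toEnd_apply_apply, hΦ, B.compat])
      (by simp only [LinearMap.comp_apply, LieModule.toEnd_apply_apply, hΦw,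
        LieModuleHom.map_lie])
  exact LinearMap.congr_fun h n

/-- A biequivariant pairing which is compatible with the two actions of `𝔥[t]` on the cyclic
vectors is `𝔸_λ`-balanced. -/
theorem HWData.pairing_balanced (Hd : HWData D lam Wl Wo) (B : CurBimod g)
    (F : Wl.M →ₗ[ℂ] Wo.M →ₗ[ℂ] B.N)
    (hFl : ∀ (x : Cur g) m n, F ⁅x, m⁆ n = ⁅x, F m n⁆)
    (hFr : ∀ (x : Cur g) m n, F m (Wo.act.ρ n x) = B.act.ρ (F m n) x)
    (hF : ∀ (h : D.H) (k : ℕ),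
      ⁅(X ^ k : Polynomial ℂ) ⊗ₜ[ℂ] (h : g), F Wl.w Wo.w⁆ =
        B.act.ρ (F Wl.w Wo.w) ((X ^ k : Polynomial ℂ) ⊗ₜ[ℂ] (h : g)))
    (a : Hd.A) (m : Wl.M) (n : Wo.M) : F (a • m) n = F m (a • n) := by
  have ha : a ∈ Algebra.adjoin ℂ {a : Hd.A | ∃ h k, a = Hd.θ h k} := by
    rw [Hd.gen]; trivial
  induction ha using Algebra.adjoin_induction generalizing m n with
  | mem a ha =>
    obtain ⟨h, k, rfl⟩ := ha
    induction m using Wl.induction generalizing n with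
    | hw =>
      induction n using Wo.induction with
      | hw => rw [Hd.theta_w, Hd.theta_wo, hFl, hFr, hF]
      | hadd a b ha hb => rw [map_add, smul_add, map_add, ha, hb]
      | hsmul c a ha => rw [smul_algebra_smul_comm, map_smul (F _) c, map_smul (F _) c, ha]
      | hact x a ha => rw [Hd.commR, hFr, hFr, ha]
    | hadd a b ha hb =>
      rw [smul_add, map_add, map_add, LinearMap.add_apply, LinearMap.add_apply, ha, hb]
    | hsmul c a ha =>
      rw [smul_algebra_smul_comm, map_smul F c, map_smul F c, LinearMap.smul_apply,
        LinearMap.smul_apply, ha]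
    | hlie x a ha => rw [Hd.commL, hFl, hFl, ha]
  | algebraMap c =>
    rw [algebraMap_smul, algebraMap_smul, map_smul, map_smul, LinearMap.smul_apply]
  | add a b _ _ ha hb => rw [add_smul, add_smul, map_add, map_add, LinearMap.add_apply, ha, hb]
  | mul a b _ _ ha hb => rw [mul_smul, ha, hb, ← mul_smul, mul_comm b a]

/-- `T_λ = 𝕎_λ ⊗_{𝔸_λ} 𝕎_λ^o` is a cyclic `𝔤[t] × 𝔤[t]`-bimodule with
generator `w̄_λ = w_λ ⊗ w_λ^o` and the defining relations
`𝔫₊[t]·w̄_λ = 0`, `w̄_λ·𝔫₋[t] = 0`, `(h ⊗ 1)·w̄_λ = w̄_λ·(h ⊗ 1) = λ(h)·w̄_λ`,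
`f_{-α}^{⟨λ,α^∨⟩+1}·w̄_λ = 0`, `w̄_λ·e_α^{⟨λ,α^∨⟩+1} = 0`, and
`(h ⊗ t^k)·w̄_λ = w̄_λ·(h ⊗ t^k)` for all `h ∈ 𝔥`, `k ≥ 0`:
the relations hold, `w̄_λ` generates, and every bimodule with a vector satisfying these
relations receives a bimodule map from `T_λ`. -/
theorem Tlambda_cyclic_with_defining_relations
    (g : Type) [LieRing g] [LieAlgebra ℂ g] [LieAlgebra.IsSimple ℂ g]
    [FiniteDimensional ℂ g] (D : TriData g) (lam : D.P)
    (Wl : GlobalWeyl D lam) (Wo : RightGlobalWeyl D lam)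
    (Hd : HWData D lam Wl Wo) :
    -- the relations hold for w̄_λ = w_λ ⊗ w_λ^o
    (∀ (p : Polynomial ℂ) (x : g), x ∈ D.nP →
      ltop Hd (p ⊗ₜ[ℂ] x) (Wl.w ⊗ₜ[Hd.A] Wo.w) = 0) ∧
    (∀ (p : Polynomial ℂ) (x : g), x ∈ D.nM →
      rtop Hd (p ⊗ₜ[ℂ] x) (Wl.w ⊗ₜ[Hd.A] Wo.w) = 0) ∧
    (∀ h : D.H,
      ltop Hd ((1 : Polynomial ℂ) ⊗ₜ[ℂ] (h : g)) (Wl.w ⊗ₜ[Hd.A] Wo.w) =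
        D.wt lam h • (Wl.w ⊗ₜ[Hd.A] Wo.w) ∧
      rtop Hd ((1 : Polynomial ℂ) ⊗ₜ[ℂ] (h : g)) (Wl.w ⊗ₜ[Hd.A] Wo.w) =
        D.wt lam h • (Wl.w ⊗ₜ[Hd.A] Wo.w)) ∧
    (∀ α : D.Δ,
      ((ltop Hd ((1 : Polynomial ℂ) ⊗ₜ[ℂ] D.f α)) ^ (D.pair lam α + 1))
        (Wl.w ⊗ₜ[Hd.A] Wo.w) = 0) ∧
    (∀ α : D.Δ,
      ((rtop Hd ((1 : Polynomial ℂ) ⊗ₜ[ℂ] D.e α)) ^ (D.pair lam α + 1))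
        (Wl.w ⊗ₜ[Hd.A] Wo.w) = 0) ∧
    (∀ (h : D.H) (k : ℕ),
      ltop Hd ((X ^ k : Polynomial ℂ) ⊗ₜ[ℂ] (h : g)) (Wl.w ⊗ₜ[Hd.A] Wo.w) =
      rtop Hd ((X ^ k : Polynomial ℂ) ⊗ₜ[ℂ] (h : g)) (Wl.w ⊗ₜ[Hd.A] Wo.w)) ∧
    -- w̄_λ generates T_λ as a bimodule
    (∀ S : Submodule ℂ (Tmod Hd), (Wl.w ⊗ₜ[Hd.A] Wo.w) ∈ S →
      (∀ (x : Cur g), ∀ z ∈ S, ltop Hd x z ∈ S) →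
      (∀ (x : Cur g), ∀ z ∈ S, rtop Hd x z ∈ S) → S = ⊤) ∧
    -- the relations are defining: universal property
    (∀ (B : CurBimod g) (v : B.N),
      (∀ (p : Polynomial ℂ) (x : g), x ∈ D.nP → ⁅p ⊗ₜ[ℂ] x, v⁆ = 0) →
      (∀ (p : Polynomial ℂ) (x : g), x ∈ D.nM → B.act.ρ v (p ⊗ₜ[ℂ] x) = 0) →
      (∀ h : D.H, ⁅(1 : Polynomial ℂ) ⊗ₜ[ℂ] (h : g), v⁆ = D.wt lam h • v ∧
        B.act.ρ v ((1 : Polynomial ℂ) ⊗ₜ[ℂ] (h : g)) = D.wt lam h • v) →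
      (∀ α : D.Δ,
        ((LieModule.toEnd ℂ (Cur g) B.N ((1 : Polynomial ℂ) ⊗ₜ[ℂ] D.f α)) ^
          (D.pair lam α + 1)) v = 0) →
      (∀ α : D.Δ,
        ((fun n => B.act.ρ n ((1 : Polynomial ℂ) ⊗ₜ[ℂ] D.e α))^[D.pair lam α + 1]) v = 0) →
      (∀ (h : D.H) (k : ℕ),
        ⁅(X ^ k : Polynomial ℂ) ⊗ₜ[ℂ] (h : g), v⁆ =
          B.act.ρ v ((X ^ k : Polynomial ℂ) ⊗ₜ[ℂ] (h : g))) →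
      ∃ φ : Tmod Hd →ₗ[ℂ] B.N,
        φ (Wl.w ⊗ₜ[Hd.A] Wo.w) = v ∧
        (∀ (x : Cur g) (z : Tmod Hd), φ (ltop Hd x z) = ⁅x, φ z⁆) ∧
        (∀ (x : Cur g) (z : Tmod Hd), φ (rtop Hd x z) = B.act.ρ (φ z) x)) := by
  refine ⟨fun p x hx => ?_, fun p x hx => ?_, fun h => ⟨?_, ?_⟩, fun α => ?_, fun α => ?_,
    fun h k => ?_, fun S hS hl hr => ?_, fun B v hnP hnM hh hf he hht => ?_⟩
  · rw [ltop_tmul, Wl.rel_n p x hx, TensorProduct.zero_tmul]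
  · rw [rtop_tmul, Wo.rel_n p x hx, TensorProduct.tmul_zero]
  · rw [ltop_tmul, Wl.rel_h, TensorProduct.smul_tmul']
  · rw [rtop_tmul, Wo.rel_h, tmul_smul_complex]
  · rw [ltop_pow_tmul, Wl.rel_f, TensorProduct.zero_tmul]
  · rw [rtop_pow_tmul, Wo.rel_e, TensorProduct.tmul_zero]
  · rw [ltop_tmul, rtop_tmul]
    cases k with
    | zero => rw [pow_zero, Wl.rel_h, Wo.rel_h, tmul_smul_complex, TensorProduct.smul_tmul']
    | succ k => rw [← Hd.theta_w, ← Hd.theta_wo, TensorProduct.smul_tmul]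
  · have hmem (m : Wl.M) (n : Wo.M) : m ⊗ₜ[Hd.A] n ∈ S := by
      induction n using Wo.induction with
      | hw =>
        induction m using Wl.induction with
        | hw => exact hS
        | hadd a b ha hb => rw [TensorProduct.add_tmul]; exact S.add_mem ha hb
        | hsmul c a ha => rw [← TensorProduct.smul_tmul']; exact S.smul_mem c ha
        | hlie x a ha => exact hl x _ ha
      | hadd a b ha hb => rw [TensorProduct.tmul_add]; exact S.add_mem ha hb
      | hsmul c a ha => rw [tmul_smul_complex]; exact S.smul_mem c ha
      | hact x a ha => exact hr x _ ha
    refine Submodule.eq_top_iff'.2 fun z => ?_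
    induction z using TensorProduct.induction_on with
    | zero => exact S.zero_mem
    | tmul m n => exact hmem m n
    | add a b ha hb => exact S.add_mem ha hb
  · obtain ⟨F, hFw, hFl, hFr⟩ := exists_biequivariant_pairing Wl Wo B v hnP hnM
      (fun h => (hh h).1) (fun h => (hh h).2) hf he
    have hbal := Hd.pairing_balanced B F hFl hFr (by rwa [hFw])
    let φ₀ : Tmod Hd →+ B.N := TensorProduct.liftAddHom
      (LinearMap.toAddMonoidHom'.comp F.toAddMonoidHom) hbal
    have hφ₀ (m : Wl.M) (n : Wo.M) : φ₀ (m ⊗ₜ[Hd.A] n) = F m n := rfl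
    let φ : Tmod Hd →ₗ[ℂ] B.N :=
      { φ₀ with
        map_smul' := fun c z => by
          change φ₀ (c • z) = c • φ₀ z
          induction z using TensorProduct.induction_on with
          | zero => simp only [smul_zero, map_zero]
          | tmul m n =>
            rw [TensorProduct.smul_tmul', hφ₀, hφ₀, map_smul, LinearMap.smul_apply]
          | add a b ha hb => rw [smul_add, map_add, map_add, ha, hb, smul_add] }
    have hφ (m : Wl.M) (n : Wo.M) : φ (m ⊗ₜ[Hd.A] n) = F m n := rfl
    refine ⟨φ, hFw, fun x z => ?_, fun x z => ?_⟩
    · induction z using TensorProduct.induction_on with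
      | zero => simp only [map_zero, lie_zero]
      | tmul m n => rw [ltop_tmul, hφ, hφ, hFl]
      | add a b ha hb => rw [map_add, map_add, map_add, ha, hb, lie_add]
    · induction z using TensorProduct.induction_on with
      | zero => simp only [map_zero, LinearMap.zero_apply]
      | tmul m n => rw [rtop_tmul, hφ, hφ, hFr]
      | add a b ha hb =>
        rw [map_add, map_add, map_add, ha, hb, map_add, LinearMap.add_apply]
end
end

section
/- Let B = span{a₁, a₂} be the two-dimensional tautological 𝔰𝔩₂-module. Then the symmetric power S^N(B[t]) = S^N(B⊗ℂ[t]) is generated, as a module over 𝔫₋^{𝔰𝔩₂}[t] = ℂf⊗ℂ[t], by the linear span of the products ∏_{k=1}^N (a₁⊗t^{r_k}) over all choices of exponents r_k ≥ 0. -/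
/-
**Statement 10.**  Let `B = span{a₁, a₂}` be the two-dimensional tautological
`𝔰𝔩₂`-module.  The symmetric power `S^N(B[t])` is generated as a module over
`𝔫₋^{𝔰𝔩₂}[t] = ℂf ⊗ ℂ[t]` by the span of the products `∏_{k=1}^N a₁ t^{r_k}`.

We model `S(B[t])` as the polynomial ring on the basis `aᵢ t^r` of `B[t]`,
i.e. `MvPolynomial (Fin 2 × ℕ) ℂ`, the variable `X (i, r)` corresponding to
`a_{i+1} ⊗ t^r`;  `S^N(B[t])` is its homogeneous component of degree `N`.
The operator `fAct s` is the action of `f ⊗ t^s ∈ 𝔫₋[t]` (the derivation with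
`f·a₁ = a₂`, `f·a₂ = 0`, i.e. `a₁ t^r ↦ a₂ t^{r+s}`).
-/

open MvPolynomial

noncomputable section

/-- Action of `f ⊗ t^s` on `S(B[t])`: the derivation sending `a₁ t^r ↦ a₂ t^{r+s}`,
`a₂ t^r ↦ 0`. -/
def fAct (s : ℕ) :
    Derivation ℂ (MvPolynomial (Fin 2 × ℕ) ℂ) (MvPolynomial (Fin 2 × ℕ) ℂ) :=
  mkDerivation ℂ (fun v => if v.1 = 0 then X (1, v.2 + s) else 0)

/-- The span of the products `∏_{k=1}^N a₁ t^{r_k}`, `r_k ≥ 0`. -/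
def topSpan (N : ℕ) : Submodule ℂ (MvPolynomial (Fin 2 × ℕ) ℂ) :=
  Submodule.span ℂ
    {P | ∃ r : Fin N → ℕ, P = ∏ k : Fin N, X ((0 : Fin 2), r k)}

/-- The product `∏ a₁ t^r` over `r ∈ A`. -/
def topProd (A : Multiset ℕ) : MvPolynomial (Fin 2 × ℕ) ℂ :=
  (A.map fun r => X ((0 : Fin 2), r)).prod

/-- The product `∏ a₂ t^r` over `r ∈ C`. -/
def botProd (C : Multiset ℕ) : MvPolynomial (Fin 2 × ℕ) ℂ :=
  (C.map fun r => X ((1 : Fin 2), r)).prod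

lemma topProd_cons (r : ℕ) (A : Multiset ℕ) :
    topProd (r ::ₘ A) = X (0, r) * topProd A := by
  simp [topProd]

lemma botProd_cons (r : ℕ) (C : Multiset ℕ) :
    botProd (r ::ₘ C) = X (1, r) * botProd C := by
  simp [botProd]

lemma topProd_replicate_zero_add (a : ℕ) (B : Multiset ℕ) :
    topProd (Multiset.replicate a 0 + B) = X (0, 0) ^ a * topProd B := by
  simp [topProd]

lemma fAct_X_zero (s r : ℕ) : fAct s (X (0, r)) = X (1, r + s) := by
  simp [fAct, mkDerivation_X]

lemma fAct_X_one (s r : ℕ) : fAct s (X (1, r)) = 0 := by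
  simp [fAct, mkDerivation_X]

lemma fAct_botProd (s : ℕ) (C : Multiset ℕ) : fAct s (botProd C) = 0 := by
  induction C using Multiset.induction_on with
  | empty => simp [botProd]
  | cons r C ih => simp [botProd_cons, Derivation.leibniz, ih, fAct_X_one]

lemma mul_fAct_topProd_mem {S : Submodule ℂ (MvPolynomial (Fin 2 × ℕ) ℂ)} (s : ℕ)
    (B : Multiset ℕ) (Z : MvPolynomial (Fin 2 × ℕ) ℂ)
    (h : ∀ b C, B = b ::ₘ C → Z * X (1, b + s) * topProd C ∈ S) :
    Z * fAct s (topProd B) ∈ S := by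
  induction B using Multiset.induction_on generalizing Z with
  | empty => simp [topProd]
  | cons r B ih =>
    have hr := h r B rfl
    have hB := ih (Z * X (0, r)) fun b C hC => by
      have := h b (r ::ₘ C) (by rw [hC, Multiset.cons_swap])
      rw [topProd_cons] at this
      convert this using 1
      ring
    rw [topProd_cons, Derivation.leibniz, fAct_X_zero]
    convert S.add_mem hB hr using 1
    simp only [smul_eq_mul]
    ring

/-- If `Y` is killed by every `f ⊗ t^s` and `S` contains all products of `m + 1` factors
`a₁ t^r` with `Y`, then one of these factors may be replaced by any `a₂ t^q`. -/
lemma topProd_mul_X_one_mul_mem {S : Submodule ℂ (MvPolynomial (Fin 2 × ℕ) ℂ)}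
    (hstab : ∀ (s : ℕ), ∀ P ∈ S, fAct s P ∈ S) {m : ℕ} {Y : MvPolynomial (Fin 2 × ℕ) ℂ}
    (hY : ∀ s, fAct s Y = 0) (hS : ∀ A : Multiset ℕ, A.card = m + 1 → topProd A * Y ∈ S)
    (q : ℕ) (A : Multiset ℕ) (hA : A.card = m) :
    topProd A * (X (1, q) * Y) ∈ S := by
  suffices H : ∀ (B : Multiset ℕ) (a q : ℕ), a + B.card = m →
      X (0, 0) ^ a * topProd B * (X (1, q) * Y) ∈ S by
    simpa using H A 0 q (by simpa using hA)
  intro B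
  induction hn : B.card generalizing B with
  | zero =>
    intro a q ha
    obtain rfl := Multiset.card_eq_zero.mp hn
    have h := hstab q _ (hS (Multiset.replicate (a + 1) 0 + 0) (by simp; omega))
    rw [topProd_replicate_zero_add, Derivation.leibniz, hY, Derivation.leibniz,
      Derivation.leibniz_pow, fAct_X_zero] at h
    have hc : ((a + 1 : ℕ) : ℂ) ≠ 0 := by exact_mod_cast a.succ_ne_zero
    rw [← S.smul_mem_iff hc]
    convert h using 1
    simp [topProd, Algebra.smul_def]
    ring
  | succ n ih =>
    intro a q ha
    have h := hstab q _ (hS (Multiset.replicate (a + 1) 0 + B) (by simp; omega))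
    have hB : (X (0, 0) ^ (a + 1) * Y) * fAct q (topProd B) ∈ S :=
      mul_fAct_topProd_mem q B _ fun b C hC => by
        have := ih C (by simpa [hC] using hn) (a + 1) (b + q) (by omega)
        convert this using 1
        ring
    rw [topProd_replicate_zero_add, Derivation.leibniz, hY, Derivation.leibniz,
      Derivation.leibniz_pow, fAct_X_zero] at h
    have hc : ((a + 1 : ℕ) : ℂ) ≠ 0 := by exact_mod_cast a.succ_ne_zero
    rw [← S.smul_mem_iff hc]
    convert S.sub_mem h hB using 1
    simp [Algebra.smul_def]
    ring

lemma topProd_mem_topSpan (A : Multiset ℕ) : topProd A ∈ topSpan A.card := by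
  induction A using Quotient.inductionOn with
  | h l =>
    refine Submodule.subset_span ⟨l.get, ?_⟩
    simp only [topProd, Multiset.quot_mk_to_coe, Multiset.map_coe, Multiset.prod_coe]
    exact (Fin.prod_univ_fun_getElem l fun r => X ((0 : Fin 2), r)).symm

lemma exists_prod_map_X_eq (D : Multiset (Fin 2 × ℕ)) :
    ∃ A C : Multiset ℕ, A.card + C.card = D.card ∧
      (D.map (X (R := ℂ))).prod = topProd A * botProd C := by
  induction D using Multiset.induction_on with
  | empty => exact ⟨0, 0, by simp [topProd, botProd]⟩
  | cons v D ih =>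
    obtain ⟨A, C, hcard, hprod⟩ := ih
    obtain ⟨i, r⟩ := v
    fin_cases i
    · refine ⟨r ::ₘ A, C, by simp; omega, ?_⟩
      simp [topProd_cons, hprod, mul_assoc]
    · refine ⟨A, r ::ₘ C, by simp; omega, ?_⟩
      simp [botProd_cons, hprod, mul_left_comm]

/-- `S^N(B[t])` is generated over `𝔫₋^{𝔰𝔩₂}[t]` by
`span(∏_{k=1}^N a₁ t^{r_k})`: every subspace containing the latter and stable under all
the operators `f ⊗ t^s` contains the whole of `S^N(B[t])`. -/
theorem symmetric_power_generated_over_nMinus_current (N : ℕ)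
    (S : Submodule ℂ (MvPolynomial (Fin 2 × ℕ) ℂ))
    (htop : topSpan N ≤ S)
    (hstab : ∀ (s : ℕ), ∀ P ∈ S, fAct s P ∈ S) :
    homogeneousSubmodule (Fin 2 × ℕ) ℂ N ≤ S := by
  have key : ∀ C A : Multiset ℕ, A.card + C.card = N → topProd A * botProd C ∈ S := by
    intro C
    induction C using Multiset.induction_on with
    | empty =>
      rintro A rfl
      simpa [botProd] using htop (topProd_mem_topSpan A)
    | cons q C ih =>
      intro A hA
      rw [botProd_cons]
      rw [Multiset.card_cons] at hA
      exact topProd_mul_X_one_mul_mem hstab (fun s => fAct_botProd s C)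
        (fun A' hA' => ih A' (by omega)) q A rfl
  intro P hP
  rw [P.as_sum]
  refine S.sum_mem fun d hd => ?_
  obtain ⟨A, C, hcard, hprod⟩ := exists_prod_map_X_eq (Finsupp.toMultiset d)
  have hmon : monomial d (coeff d P) = coeff d P • (topProd A * botProd C) := by
    rw [← hprod, monomial_eq, Finsupp.toMultiset_map, Finsupp.prod_toMultiset, smul_eq_C_mul,
      Finsupp.prod_mapDomain_index (by simp) (by simp [pow_add])]
  rw [hmon]
  refine S.smul_mem _ (key C A ?_)
  have hdeg := (mem_homogeneousSubmodule N P).mp hP (mem_support_iff.mp hd)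
  rw [hcard, Finsupp.card_toMultiset, ← hdeg, Finsupp.weight_apply]
  simp [Finsupp.sum]

end
end

section
/- Let V be an m-dimensional and U an n-dimensional complex vector space with n ≤ m. Then S^N(V⊗U⊗ℂ[t]) is generated by its subspace S^N(V⊗U) as a 𝔟₋[t]×𝔟₊[t]-bimodule, where 𝔟₋ ⊂ 𝔤𝔩_m acts on the left and 𝔟₊ ⊂ 𝔤𝔩_n acts on the right; explicitly, it is generated by the elements ∏_{i=1}^n (v_i u_i)^{r_{ii}} with Σ_i r_{ii} = N, for weight bases {v_i} of V and {u_j} of U. -/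
/-
**Statement 11.** Let `V = ℂ^m`, `U = ℂ^n`, `n ≤ m`.  Then `S^N(V ⊗ U ⊗ ℂ[t])` is
generated as a `𝔟₋[t] × 𝔟₊[t]`-bimodule by the elements `∏_{i=1}^n (v_i u_i)^{r_{ii}}`,
`Σ r_{ii} = N` (in particular by its subspace `S^N(V ⊗ U)`).

We model `S(V ⊗ U ⊗ ℂ[t])` as the polynomial ring `MvPolynomial (Fin m × Fin n × ℕ) ℂ`,
the variable `X (i, j, r)` corresponding to `v_i ⊗ u_j ⊗ t^r`; `S^N` is the homogeneous
component of degree `N`, and `S^N(V ⊗ U)` is the part involving only the variables of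
`t`-level `0`.  The left action of the elementary matrix current `E_{ab} t^s ∈ 𝔤𝔩_m[t]`
is the derivation `elemL a b s` with `v_b u_j t^r ↦ v_a u_j t^{r+s}`.
-/

open MvPolynomial

noncomputable section

variable (m n : ℕ)

/-- Left action of `E_{ab} ⊗ t^s ∈ 𝔤𝔩_m[t]` on `S(V ⊗ U ⊗ ℂ[t])`:
the derivation `v_b u_j t^r ↦ v_a u_j t^{r+s}`. -/
def elemL (a b : Fin m) (s : ℕ) :
    Derivation ℂ (MvPolynomial (Fin m × Fin n × ℕ) ℂ)
      (MvPolynomial (Fin m × Fin n × ℕ) ℂ) :=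
  mkDerivation ℂ (fun v => if v.1 = b then X (a, v.2.1, v.2.2 + s) else 0)

/-- Right action of `E_{cd} ⊗ t^s ∈ 𝔤𝔩_n[t]` on `S(V ⊗ U ⊗ ℂ[t])`:
the derivation `v_i u_c t^r ↦ v_i u_d t^{r+s}`. -/
def elemR (c d : Fin n) (s : ℕ) :
    Derivation ℂ (MvPolynomial (Fin m × Fin n × ℕ) ℂ)
      (MvPolynomial (Fin m × Fin n × ℕ) ℂ) :=
  mkDerivation ℂ (fun v => if v.2.1 = c then X (v.1, d, v.2.2 + s) else 0)

/-- The subspace `S^N(V ⊗ U) ⊆ S^N(V ⊗ U ⊗ ℂ[t])`: degree-`N` polynomials in the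
`t`-level-zero variables. -/
def levelZeroPart (N : ℕ) : Submodule ℂ (MvPolynomial (Fin m × Fin n × ℕ) ℂ) :=
  (homogeneousSubmodule (Fin m × Fin n) ℂ N).map
    (rename (fun p : Fin m × Fin n => (p.1, p.2, (0 : ℕ)))).toLinearMap

/-- The span of the products `∏_{i=1}^n (v_i u_i t^0)^{r_i}` with `Σ_i r_i = N`. -/
def diagSpan (N : ℕ) (hnm : n ≤ m) : Submodule ℂ (MvPolynomial (Fin m × Fin n × ℕ) ℂ) :=
  Submodule.span ℂ
    {P | ∃ r : Fin n → ℕ, (∑ i, r i) = N ∧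
      P = ∏ i : Fin n, (X ((Fin.castLE hnm i), i, (0 : ℕ))) ^ (r i)}

/-- The Leibniz rule for a product indexed by a multiset. -/
theorem Derivation.leibniz_multiset_prod_map {R A σ : Type*} [DecidableEq σ] [CommRing R]
    [CommRing A] [Algebra R A] (D : Derivation R A A) (f : σ → A) (s : Multiset σ) :
    D (s.map f).prod = (s.map fun v => ((s.erase v).map f).prod * D (f v)).sum := by
  induction s using Multiset.induction_on with
  | empty => simp
  | cons a s ih =>
    rw [Multiset.map_cons, Multiset.prod_cons, D.leibniz, ih, Multiset.map_cons,
      Multiset.sum_cons, Multiset.erase_cons_head, smul_eq_mul, smul_eq_mul,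
      ← Multiset.sum_map_mul_left, add_comm]
    congr 2
    refine Multiset.map_congr rfl fun v hv => ?_
    by_cases hav : a = v
    · subst hav
      rw [Multiset.erase_cons_head, ← mul_assoc, ← Multiset.prod_cons, ← Multiset.map_cons f,
        Multiset.cons_erase hv]
    · rw [Multiset.erase_cons_tail _ hav, Multiset.map_cons, Multiset.prod_cons, mul_assoc]

/-- Suppose `D` sends the variable `x` to `y`, and each other variable to zero or, if the
variable satisfies `bad`, to some variable. If a `D`-stable subspace `S` contains all monomials
of degree `N` with at most `k` bad variables, and `M` has at most `k` bad variables, then `S`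
contains the monomial `y * M` of degree `N`. -/
theorem MvPolynomial.prod_cons_mem_of_derivation {K σ : Type*} [Field K] [CharZero K]
    (S : Submodule K (MvPolynomial σ K)) (bad : σ → Prop) [DecidablePred bad] (N k : ℕ)
    (hk : ∀ s : Multiset σ, s.card = N → s.countP bad ≤ k →
      (s.map (X : σ → MvPolynomial σ K)).prod ∈ S)
    (D : Derivation K (MvPolynomial σ K) (MvPolynomial σ K)) (hD : ∀ P ∈ S, D P ∈ S)
    {x y : σ} (hxbad : ¬ bad x) (hxy : D (X x) = X y)
    (hv : ∀ v, v ≠ x → D (X v) = 0 ∨ bad v ∧ ∃ w, D (X v) = X w)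
    (M : Multiset σ) (hcard : (y ::ₘ M).card = N) (hM : M.countP bad ≤ k) :
    ((y ::ₘ M).map (X : σ → MvPolynomial σ K)).prod ∈ S := by
  classical
  set s := x ::ₘ M with hs
  have hs_card : s.card = N := by simpa [hs] using hcard
  have hs_bad : s.countP bad ≤ k := by rwa [hs, Multiset.countP_cons_of_neg _ hxbad]
  have hxs : x ∈ s := Multiset.mem_cons_self x M
  have hDs := hD _ (hk s hs_card hs_bad)
  rw [D.leibniz_multiset_prod_map, Finset.sum_multiset_map_count,
    ← Finset.add_sum_erase _ _ (Multiset.mem_toFinset.2 hxs)] at hDs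
  have hrest : ∀ v ∈ s.toFinset.erase x,
      s.count v • (((s.erase v).map (X : σ → MvPolynomial σ K)).prod * D (X v)) ∈ S := by
    intro v hvs
    obtain ⟨hvx, hvs⟩ := Finset.mem_erase.1 hvs
    rw [Multiset.mem_toFinset] at hvs
    refine nsmul_mem ?_ _
    rcases hv v hvx with h | ⟨hbad, w, h⟩
    · simp [h]
    · rw [h, mul_comm, ← Multiset.prod_cons, ← Multiset.map_cons X]
      refine hk _ ?_ ?_
      · rw [Multiset.card_cons, Multiset.card_erase_add_one hvs, hs_card]
      · have hsv : s.countP bad = (s.erase v).countP bad + 1 := by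
          rw [← Multiset.countP_cons_of_pos _ hbad, Multiset.cons_erase hvs]
        rw [Multiset.countP_cons]
        split_ifs <;> omega
  have hmain := (Submodule.add_mem_iff_left S (Submodule.sum_mem S hrest)).1 hDs
  rw [hxy, hs, Multiset.erase_cons_head, mul_comm, ← Multiset.prod_cons, ← Multiset.map_cons X,
    ← Nat.cast_smul_eq_nsmul K] at hmain
  refine (Submodule.smul_mem_iff S ?_).1 hmain
  rw [Nat.cast_ne_zero, Multiset.count_cons_self]
  exact Nat.succ_ne_zero _

/-- A subspace containing all monomials of degree `N` contains every homogeneous polynomial of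
degree `N`. -/
theorem MvPolynomial.homogeneousSubmodule_le_of_prod_mem {K σ : Type*} [Field K]
    (S : Submodule K (MvPolynomial σ K)) (N : ℕ)
    (h : ∀ s : Multiset σ, s.card = N → (s.map (X : σ → MvPolynomial σ K)).prod ∈ S) :
    homogeneousSubmodule σ K N ≤ S := by
  intro P hP
  rw [mem_homogeneousSubmodule] at hP
  rw [P.as_sum]
  refine Submodule.sum_mem S fun d hd => ?_
  have hdeg : (Finsupp.toMultiset d).card = N := by
    rw [Finsupp.card_toMultiset, ← hP (mem_support_iff.1 hd), Finsupp.weight_apply]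
    simp [Finsupp.sum]
  have hmem := S.smul_mem (P.coeff d) (h _ hdeg)
  rwa [Finsupp.toMultiset_map, Finsupp.prod_toMultiset, Finsupp.prod_mapDomain_index
    (fun _ => pow_zero _) (fun _ _ _ => pow_add _ _ _), ← C_mul', ← monomial_eq] at hmem

/-- For `n ≤ m`, `S^N(V ⊗ U ⊗ ℂ[t])` is generated by the span of the
elements `∏_{i=1}^n (v_i u_i)^{r_{ii}}`, `Σ r_{ii} = N`, as a `𝔟₋[t] × 𝔟₊[t]`-bimodule:
any subspace containing this span and stable under the left operators `E_{ab} t^s`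
(`a ≥ b`, lower-triangular Borel of `𝔤𝔩_m`) and under the right operators `E_{cd} t^s`
(`c ≤ d`, upper-triangular Borel of `𝔤𝔩_n`) contains all of `S^N(V ⊗ U ⊗ ℂ[t])`. -/
theorem symmetric_power_generated_as_borel_bimodule
    (N : ℕ) (hnm : n ≤ m)
    (S : Submodule ℂ (MvPolynomial (Fin m × Fin n × ℕ) ℂ))
    (h0 : diagSpan m n N hnm ≤ S)
    (hstabL : ∀ (a b : Fin m), b ≤ a → ∀ (s : ℕ), ∀ P ∈ S, elemL m n a b s P ∈ S)
    (hstabR : ∀ (c d : Fin n), c ≤ d → ∀ (s : ℕ), ∀ P ∈ S, elemR m n c d s P ∈ S) :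
    homogeneousSubmodule (Fin m × Fin n × ℕ) ℂ N ≤ S := by
  classical
  set bad : Fin m × Fin n × ℕ → Prop := fun v => v.1 ≠ Fin.castLE hnm v.2.1 ∨ v.2.2 ≠ 0
    with hbad
  refine homogeneousSubmodule_le_of_prod_mem S N fun s hs => ?_
  suffices H : ∀ k : ℕ, ∀ s : Multiset (Fin m × Fin n × ℕ), s.card = N → s.countP bad ≤ k →
      (s.map (X : _ → MvPolynomial (Fin m × Fin n × ℕ) ℂ)).prod ∈ S from H _ s hs le_rfl
  intro k
  induction k with
  | zero =>
    intro s hs hgood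
    have hgood' : ∀ v ∈ s, (Fin.castLE hnm v.2.1, v.2.1, 0) = v := by
      intro v hv
      have := Multiset.countP_eq_zero.1 (Nat.le_zero.1 hgood) v hv
      simp only [hbad, not_or, not_not] at this
      exact Prod.ext this.1.symm (Prod.ext rfl this.2.symm)
    refine h0 (Submodule.subset_span ⟨fun i => (s.map fun v => v.2.1).count i, ?_, ?_⟩)
    · rw [Multiset.sum_count_eq_card fun a _ => Finset.mem_univ a, Multiset.card_map, hs]
    · conv_lhs => rw [← Multiset.map_id' s, ← Multiset.map_congr rfl hgood', Multiset.map_map]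
      rw [← Finset.prod_subset (Finset.subset_univ (s.map fun v => v.2.1).toFinset),
        ← Finset.prod_multiset_map_count, Multiset.map_map]
      · rfl
      · intro i _ hi
        rw [Multiset.mem_toFinset] at hi
        simp only [Multiset.count_eq_zero_of_notMem hi, pow_zero]
  | succ k ih =>
    intro s hs hsk
    by_cases hex : ∃ v ∈ s, bad v
    · obtain ⟨⟨j, i, r⟩, hvs, hv⟩ := hex
      obtain ⟨M, rfl⟩ := Multiset.exists_cons_of_mem hvs
      rw [Multiset.countP_cons_of_pos _ hv, Nat.add_le_add_iff_right] at hsk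
      rcases le_total (Fin.castLE hnm i) j with hij | hij
      · refine prod_cons_mem_of_derivation S bad N k ih (elemL m n j (Fin.castLE hnm i) r)
          (hstabL _ _ hij r) (x := (Fin.castLE hnm i, i, 0)) (by simp [hbad])
          (by simp [elemL, mkDerivation_X]) ?_ M hs hsk
        rintro ⟨a, b, c⟩ hne
        by_cases ha : a = Fin.castLE hnm i
        · subst ha
          refine Or.inr ⟨?_, (j, b, c + r), by simp [elemL, mkDerivation_X]⟩
          by_contra hgood
          simp only [hbad, not_or, not_not, Fin.castLE_inj] at hgood
          exact hne (by rw [hgood.1, hgood.2])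
        · exact Or.inl (by simp [elemL, mkDerivation_X, ha])
      · obtain ⟨l, rfl⟩ : ∃ l : Fin n, Fin.castLE hnm l = j :=
          ⟨⟨j, lt_of_le_of_lt hij i.isLt⟩, rfl⟩
        refine prod_cons_mem_of_derivation S bad N k ih (elemR m n l i r)
          (hstabR _ _ hij r) (x := (Fin.castLE hnm l, l, 0)) (by simp [hbad])
          (by simp [elemR, mkDerivation_X]) ?_ M hs hsk
        rintro ⟨a, b, c⟩ hne
        by_cases hb : b = l
        · subst hb
          refine Or.inr ⟨?_, (a, i, c + r), by simp [elemR, mkDerivation_X]⟩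
          by_contra hgood
          simp only [hbad, not_or, not_not] at hgood
          exact hne (by rw [hgood.1, hgood.2])
        · exact Or.inl (by simp [elemR, mkDerivation_X, hb])
    · push Not at hex
      exact ih s hs ((Multiset.countP_eq_zero.2 hex).le.trans (Nat.zero_le k))

end
end

section
/- Let V be an m-dimensional and U an n-dimensional complex vector space with n ≤ m. Then S^N(V⊗U⊗ℂ[t]) is generated by its subspace S^N(V⊗U) as a left 𝔤𝔩_m[t]-module. -/
/-
**Statement 12.** Let `V = ℂ^m`, `U = ℂ^n`, `n ≤ m`.  Then `S^N(V ⊗ U ⊗ ℂ[t])` is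
generated by its subspace `S^N(V ⊗ U)` as a left `𝔤𝔩_m[t]`-module.

We model `S(V ⊗ U ⊗ ℂ[t])` as the polynomial ring `MvPolynomial (Fin m × Fin n × ℕ) ℂ`,
the variable `X (i, j, r)` corresponding to `v_i ⊗ u_j ⊗ t^r`; `S^N` is the homogeneous
component of degree `N`, and `S^N(V ⊗ U)` is the part involving only the variables of
`t`-level `0`.  The left action of the elementary matrix current `E_{ab} t^s ∈ 𝔤𝔩_m[t]`
is the derivation `elemL a b s` with `v_b u_j t^r ↦ v_a u_j t^{r+s}`.
-/

open MvPolynomial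

noncomputable section

variable (m n : ℕ)

/-- The degree-`N` monomial whose `k`-th factor is the variable `X (f k)`. -/
def factorProd {σ : Type*} {N : ℕ} (f : Fin N → σ) : MvPolynomial σ ℂ :=
  ∏ k, X (f k)

theorem monomial_one_eq_factorProd {σ : Type*} {N : ℕ} (d : σ →₀ ℕ) (hd : d.degree = N) :
    ∃ f : Fin N → σ, monomial d (1 : ℂ) = factorProd f := by
  classical
  obtain ⟨l, hl⟩ := Quot.exists_rep (Finsupp.toMultiset d)
  replace hl : (l : Multiset σ) = Finsupp.toMultiset d := hl
  have hlen : l.length = N := by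
    rw [← hd, ← Multiset.coe_card, hl, Finsupp.card_toMultiset, Finsupp.degree]
    rfl
  subst hlen
  refine ⟨l.get, ?_⟩
  have hprod : ((Finsupp.toMultiset d).map (X : σ → MvPolynomial σ ℂ)).prod = monomial d 1 := by
    rw [Finsupp.toMultiset_map, Finsupp.prod_toMultiset,
      Finsupp.prod_mapDomain_index (by simp) (by simp [pow_add]), monomial_eq]
    simp
  rw [← hprod, ← hl, factorProd, ← List.prod_ofFn, Multiset.map_coe, Multiset.prod_coe]
  congr 1
  exact (List.ofFn_getElem_eq_map l X).symm

theorem homogeneousSubmodule_le_of_factorProd_mem {σ : Type*} {N : ℕ}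
    (S : Submodule ℂ (MvPolynomial σ ℂ)) (h : ∀ f : Fin N → σ, factorProd f ∈ S) :
    homogeneousSubmodule σ ℂ N ≤ S := by
  intro P hP
  rw [P.as_sum]
  refine S.sum_mem fun d hd => ?_
  have hdeg : d.degree = N := by
    have := hP (mem_support_iff.mp hd)
    rwa [Finsupp.degree_eq_weight_one]
  obtain ⟨f, hf⟩ := monomial_one_eq_factorProd d hdeg
  rw [← mul_one (coeff d P), ← smul_eq_mul, ← smul_monomial, hf]
  exact S.smul_mem _ (h f)

theorem factorProd_comp_equiv {σ : Type*} {N : ℕ} (f : Fin N → σ) (e : Fin N ≃ Fin N) :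
    factorProd (f ∘ e) = factorProd f :=
  e.prod_comp fun k => (X (f k) : MvPolynomial σ ℂ)

theorem derivation_prod {R A ι : Type*} [CommSemiring R] [CommSemiring A] [Algebra R A]
    [DecidableEq ι] (D : Derivation R A A) (s : Finset ι) (f : ι → A) :
    D (∏ k ∈ s, f k) = ∑ k ∈ s, D (f k) * ∏ l ∈ s.erase k, f l := by
  induction s using Finset.induction_on with
  | empty => simp
  | insert a s ha ih =>
    rw [Finset.prod_insert ha, D.leibniz, ih, Finset.sum_insert ha, Finset.erase_insert ha,
      smul_eq_mul, smul_eq_mul, Finset.mul_sum, add_comm, mul_comm (∏ k ∈ s, f k)]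
    congr 1
    refine Finset.sum_congr rfl fun k hk => ?_
    have hka : a ≠ k := fun h => ha (h ▸ hk)
    rw [Finset.erase_insert_of_ne hka, Finset.prod_insert (by simp [ha])]
    ring

theorem elemL_factorProd {N : ℕ} (a b : Fin m) (s : ℕ) (f : Fin N → Fin m × Fin n × ℕ) :
    elemL m n a b s (factorProd f) = ∑ k, if (f k).1 = b then
      factorProd (Function.update f k (a, (f k).2.1, (f k).2.2 + s)) else 0 := by
  rw [factorProd, derivation_prod]
  refine Finset.sum_congr rfl fun k _ => ?_
  rw [elemL, mkDerivation_X]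
  split_ifs
  · rw [factorProd, ← Finset.mul_prod_erase _ _ (Finset.mem_univ k), Function.update_self]
    congr 1
    refine Finset.prod_congr rfl fun l hl => ?_
    rw [Function.update_of_ne (Finset.ne_of_mem_erase hl)]
  · simp

theorem factorProd_mem_levelZeroPart {N : ℕ} (f : Fin N → Fin m × Fin n × ℕ)
    (hf : ∀ k, (f k).2.2 = 0) : factorProd f ∈ levelZeroPart m n N := by
  refine ⟨∏ k, X ((f k).1, (f k).2.1), ?_, ?_⟩
  · have := IsHomogeneous.prod Finset.univ
      (fun k => (X ((f k).1, (f k).2.1) : MvPolynomial (Fin m × Fin n) ℂ)) (fun _ => 1)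
      fun k _ => isHomogeneous_X _ _
    simpa using this
  · simp only [AlgHom.toLinearMap_apply, map_prod, rename_X, factorProd]
    refine Finset.prod_congr rfl fun k _ => ?_
    rw [← hf k]

/-- A sum whose terms are each either `x` or in `S`, and which has `x` as a term,
lies in `S` only if `x` does. -/
theorem mem_of_sum_mem_of_eq_or_mem {ι M : Type*} [Fintype ι] [AddCommGroup M] [Module ℂ M]
    (S : Submodule ℂ M) (x : M) (T : ι → M) (k₀ : ι) (h₀ : T k₀ = x)
    (hT : ∀ k, T k = x ∨ T k ∈ S) (hsum : ∑ k, T k ∈ S) : x ∈ S := by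
  classical
  rw [← Finset.sum_filter_add_sum_filter_not Finset.univ (fun k => T k = x)] at hsum
  have hrest : ∑ k with ¬ T k = x, T k ∈ S :=
    S.sum_mem fun k hk => (hT k).resolve_left (Finset.mem_filter.mp hk).2
  have hmul := (S.add_mem_iff_left hrest).mp hsum
  rw [Finset.sum_congr rfl fun k hk => (Finset.mem_filter.mp hk).2, Finset.sum_const,
    ← Nat.cast_smul_eq_nsmul ℂ] at hmul
  refine (S.smul_mem_iff ?_).mp hmul
  exact Nat.cast_ne_zero.mpr (Finset.card_ne_zero_of_mem (a := k₀) (by simp [h₀]))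

/-- Induction on the number of factors other than the `v_j ⊗ u_j ⊗ t^0`. -/
theorem factorProd_mem_of_stable {N : ℕ} (hnm : n ≤ m)
    (S : Submodule ℂ (MvPolynomial (Fin m × Fin n × ℕ) ℂ))
    (h0 : levelZeroPart m n N ≤ S)
    (hstab : ∀ (a b : Fin m) (s : ℕ), ∀ P ∈ S, elemL m n a b s P ∈ S)
    (f : Fin N → Fin m × Fin n × ℕ) : factorProd f ∈ S := by
  let diag : Fin n → Fin m × Fin n × ℕ := fun j => (Fin.castLE hnm j, j, 0)
  generalize hB : (Finset.univ.filter fun k => f k ≠ diag (f k).2.1).card = B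
  induction B using Nat.strong_induction_on generalizing f with
  | _ B ih =>
    subst hB
    by_cases hall : ∀ k, f k = diag (f k).2.1
    · exact h0 (factorProd_mem_levelZeroPart m n f fun k => by rw [hall k])
    push Not at hall
    obtain ⟨k₀, hk₀⟩ := hall
    set j := (f k₀).2.1 with hj
    set g := Function.update f k₀ (diag j) with hg
    have hgS : factorProd g ∈ S := by
      refine ih _ (Finset.card_lt_card ?_) g rfl
      refine Finset.ssubset_iff_of_subset ?_ |>.mpr ⟨k₀, by simpa using hk₀, by simp [hg, diag]⟩
      intro k
      by_cases hk : k = k₀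
      · subst hk; simp [hg, diag]
      · simp [hg, hk]
    have hD := hstab (f k₀).1 (Fin.castLE hnm j) (f k₀).2.2 _ hgS
    rw [elemL_factorProd] at hD
    refine mem_of_sum_mem_of_eq_or_mem S (factorProd f) _ k₀ ?_ (fun k => ?_) hD
    · simp [hg, diag, hj]
    by_cases hk : k = k₀
    · left; simp [hk, hg, diag, hj]
    split_ifs with hrow
    swap
    · right; exact S.zero_mem
    have hgk : g k = f k := by simp [hg, hk]
    rw [hgk] at hrow ⊢
    by_cases hgood : f k = diag (f k).2.1
    · left
      have hcol : (f k).2.1 = j := by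
        rw [hgood] at hrow
        exact Fin.castLE_injective hnm hrow
      rw [hcol] at hgood
      rw [← factorProd_comp_equiv f (Equiv.swap k k₀)]
      congr 1
      funext l
      by_cases hl : l = k
      · subst hl; simp [hgood, diag, hj]
      by_cases hl₀ : l = k₀
      · subst hl₀; simp [hg, hl, hgood]
      · simp [hg, hl, hl₀, Equiv.swap_apply_of_ne_of_ne hl hl₀]
    · right
      refine ih _ (Finset.card_lt_card ?_) _ rfl
      refine Finset.ssubset_iff_of_subset ?_ |>.mpr
        ⟨k₀, by simpa using hk₀, by simp [hg, diag, Ne.symm hk]⟩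
      intro l
      by_cases hl : l = k
      · subst hl; simpa using fun _ => hgood
      by_cases hl₀ : l = k₀
      · subst hl₀; simp [hg, hl, diag]
      · simp [hg, hl, hl₀]

/-- For `n ≤ m`, `S^N(V ⊗ U ⊗ ℂ[t])` is generated by `S^N(V ⊗ U)` as a
left `𝔤𝔩_m[t]`-module: any subspace containing `S^N(V ⊗ U)` and stable under all left
operators `E_{ab} t^s` contains all of `S^N(V ⊗ U ⊗ ℂ[t])`. -/
theorem symmetric_power_generated_as_left_gl_module
    (N : ℕ) (hnm : n ≤ m)
    (S : Submodule ℂ (MvPolynomial (Fin m × Fin n × ℕ) ℂ))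
    (h0 : levelZeroPart m n N ≤ S)
    (hstab : ∀ (a b : Fin m) (s : ℕ), ∀ P ∈ S, elemL m n a b s P ∈ S) :
    homogeneousSubmodule (Fin m × Fin n × ℕ) ℂ N ≤ S :=
  homogeneousSubmodule_le_of_factorProd_mem S (factorProd_mem_of_stable m n hnm S h0 hstab)

end
end

section
/- Assume dim V > n. The map ψ sending the element (∏_{i=1}^n t_i^{a_i})·σ of ℂ[𝔖_n]⋉ℂ[t₁,…,t_n] to the endomorphism v₁t^{b₁}⊗…⊗v_n t^{b_n} ↦ v_{σ⁻¹(1)}t^{a₁+b_{σ⁻¹(1)}}⊗…⊗v_{σ⁻¹(n)}t^{a_n+b_{σ⁻¹(n)}} defines an isomorphism of algebras between ℂ[𝔖_n]⋉ℂ[t₁,…,t_n] and the algebra End_{𝔰𝔩_V[t]}(V[t]^{⊗n}) of 𝔰𝔩_V[t]-module endomorphisms of V[t]^{⊗n}. -/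
/-
**Statement 16.** For `dim V = m > n`, the map
`ψ : (∏ tᵢ^{aᵢ})·σ ↦ (v₁t^{b₁} ⊗ ⋯ ⊗ vₙt^{bₙ} ↦ v_{σ⁻¹(1)}t^{a₁+b_{σ⁻¹(1)}} ⊗ ⋯)`
is an algebra isomorphism `ℂ[𝔖_n] ⋉ ℂ[t₁,…,tₙ] ≅ End_{𝔰𝔩_V[t]}(V[t]^{⊗n})`.

We model `V[t]^{⊗n}` by its monomial basis: `M := (Fin n → Fin m × ℕ) →₀ ℂ`, the basis
vector `e_w` corresponding to `v_{w(1).1} t^{w(1).2} ⊗ ⋯ ⊗ v_{w(n).1} t^{w(n).2}`.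
The diagonal action of `E_{ab} t^s ∈ 𝔤𝔩_m[t]` is `elemAct a b s`; the algebra
`End_{𝔰𝔩_V[t]}(V[t]^{⊗n})` is the centralizer of the spanning operators of `𝔰𝔩_m[t]`
(the `E_{ab} t^s`, `a ≠ b`, and `(E_{aa} - E_{cc}) t^s`).
The smash product `ℂ[𝔖_n] ⋉ ℂ[t₁,…,tₙ]` has monomial basis `t^a σ`,
`(a, σ) : (Fin n →₀ ℕ) × 𝔖_n`, with multiplication
`(t^a σ)(t^b τ) = t^{a + σ·b} (στ)`, `σ·b = b ∘ σ⁻¹`.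
-/

noncomputable section

variable (m n : ℕ)

/-- The tensor power `V[t]^{⊗n}` (monomial-basis model). -/
abbrev TPow := (Fin n → Fin m × ℕ) →₀ ℂ

/-- Diagonal action of `E_{ab} t^s ∈ 𝔤𝔩_m[t]` on `V[t]^{⊗n}`. -/
def elemAct (a b : Fin m) (s : ℕ) : TPow m n →ₗ[ℂ] TPow m n :=
  Finsupp.lsum ℂ fun w =>
    LinearMap.toSpanSingleton ℂ (TPow m n)
      (∑ i : Fin n, if (w i).1 = b then
        Finsupp.single (Function.update w i (a, (w i).2 + s)) (1 : ℂ) else 0)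

/-- The commutant `End_{𝔰𝔩_V[t]}(V[t]^{⊗n})`: the centralizer of (a spanning set of)
the image of `𝔰𝔩_m[t]` in `End(V[t]^{⊗n})`. -/
def slEndo : Subalgebra ℂ (Module.End ℂ (TPow m n)) :=
  Subalgebra.centralizer ℂ
    ({f | ∃ (a b : Fin m) (s : ℕ), a ≠ b ∧ f = elemAct m n a b s} ∪
     {f | ∃ (a c : Fin m) (s : ℕ), f = elemAct m n a a s - elemAct m n c c s})

/-- The operator `ψ(t^a σ)` on `V[t]^{⊗n}`:
`v₁t^{b₁} ⊗ ⋯ ⊗ vₙt^{bₙ} ↦ v_{σ⁻¹(1)}t^{a₁+b_{σ⁻¹(1)}} ⊗ ⋯ ⊗ v_{σ⁻¹(n)}t^{aₙ+b_{σ⁻¹(n)}}`. -/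
def smashOp (p : (Fin n →₀ ℕ) × Equiv.Perm (Fin n)) : TPow m n →ₗ[ℂ] TPow m n :=
  Finsupp.lmapDomain ℂ ℂ
    (fun w => fun i => ((w (p.2⁻¹ i)).1, p.1 i + (w (p.2⁻¹ i)).2))

/-- The linear map `ψ` from (the underlying space of) `ℂ[𝔖_n] ⋉ ℂ[t₁,…,tₙ]` to
`End(V[t]^{⊗n})`. -/
def smashToEnd : (((Fin n →₀ ℕ) × Equiv.Perm (Fin n)) →₀ ℂ) →ₗ[ℂ]
    Module.End ℂ (TPow m n) :=
  Finsupp.lsum ℂ fun p => LinearMap.toSpanSingleton ℂ _ (smashOp m n p)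

/-- The effect of `ψ(t^a σ)` on the index of a monomial basis vector. -/
def smashWord (p : (Fin n →₀ ℕ) × Equiv.Perm (Fin n)) (w : Fin n → Fin m × ℕ) :
    Fin n → Fin m × ℕ :=
  fun i => ((w (p.2⁻¹ i)).1, p.1 i + (w (p.2⁻¹ i)).2)

/-- The index of `v₁ ⊗ ⋯ ⊗ vₙ`, whose letters are pairwise distinct. -/
def baseWord (h : n < m) : Fin n → Fin m × ℕ := fun i => (Fin.castLE h.le i, 0)

variable {m n}

theorem elemAct_single (a b : Fin m) (s : ℕ) (w : Fin n → Fin m × ℕ) (x : ℂ) :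
    elemAct m n a b s (Finsupp.single w x) =
      x • ∑ i : Fin n, if (w i).1 = b then
        Finsupp.single (Function.update w i (a, (w i).2 + s)) (1 : ℂ) else 0 := by
  simp [elemAct]

theorem smashOp_single (p : (Fin n →₀ ℕ) × Equiv.Perm (Fin n)) (w : Fin n → Fin m × ℕ)
    (x : ℂ) : smashOp m n p (Finsupp.single w x) = Finsupp.single (smashWord m n p w) x := by
  simp only [smashOp, Finsupp.lmapDomain_apply, Finsupp.mapDomain_single]
  rfl

theorem smashToEnd_single (p : (Fin n →₀ ℕ) × Equiv.Perm (Fin n)) (x : ℂ) :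
    smashToEnd m n (Finsupp.single p x) = x • smashOp m n p := by
  simp [smashToEnd]

theorem smashToEnd_apply_single (c : ((Fin n →₀ ℕ) × Equiv.Perm (Fin n)) →₀ ℂ)
    (w : Fin n → Fin m × ℕ) :
    smashToEnd m n c (Finsupp.single w 1) =
      Finsupp.mapDomain (fun p => smashWord m n p w) c := by
  induction c using Finsupp.induction_linear with
  | zero => simp
  | add c d hc hd => rw [map_add, LinearMap.add_apply, hc, hd, Finsupp.mapDomain_add]
  | single p x =>
    rw [smashToEnd_single, LinearMap.smul_apply, smashOp_single, Finsupp.mapDomain_single,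
      Finsupp.smul_single, smul_eq_mul, mul_one]

theorem smashWord_update (p : (Fin n →₀ ℕ) × Equiv.Perm (Fin n)) (w : Fin n → Fin m × ℕ)
    (i : Fin n) (a : Fin m) (s : ℕ) :
    smashWord m n p (Function.update w i (a, (w i).2 + s)) =
      Function.update (smashWord m n p w) (p.2 i)
        (a, (smashWord m n p w (p.2 i)).2 + s) := by
  funext j
  obtain ⟨k, rfl⟩ := p.2.surjective j
  by_cases hk : k = i
  · subst hk
    simp [smashWord, add_assoc]
  · simp [smashWord, Function.update_of_ne hk, Function.update_of_ne (p.2.injective.ne hk)]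

theorem elemAct_mul_smashOp (a b : Fin m) (s : ℕ)
    (p : (Fin n →₀ ℕ) × Equiv.Perm (Fin n)) :
    (elemAct m n a b s * smashOp m n p : Module.End ℂ (TPow m n)) =
      smashOp m n p * elemAct m n a b s := by
  refine Finsupp.lhom_ext' fun w => LinearMap.ext_ring ?_
  simp only [LinearMap.comp_apply, Module.End.mul_apply, Finsupp.lsingle_apply,
    smashOp_single, elemAct_single, one_smul, map_sum]
  rw [← Equiv.sum_comp p.2]
  refine Finset.sum_congr rfl fun i _ => ?_
  have hi : (smashWord m n p w (p.2 i)).1 = (w i).1 := by simp [smashWord]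
  rw [hi]
  split_ifs
  · rw [smashOp_single, smashWord_update]
  · simp

theorem elemAct_mul_smashToEnd (a b : Fin m) (s : ℕ)
    (c : ((Fin n →₀ ℕ) × Equiv.Perm (Fin n)) →₀ ℂ) :
    elemAct m n a b s * smashToEnd m n c = smashToEnd m n c * elemAct m n a b s := by
  induction c using Finsupp.induction_linear with
  | zero => simp
  | add c d hc hd => rw [map_add, mul_add, add_mul, hc, hd]
  | single p x =>
    rw [smashToEnd_single, mul_smul_comm, smul_mul_assoc, elemAct_mul_smashOp]

theorem smashToEnd_mem_slEndo (c : ((Fin n →₀ ℕ) × Equiv.Perm (Fin n)) →₀ ℂ) :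
    smashToEnd m n c ∈ slEndo m n := by
  rw [slEndo, Subalgebra.mem_centralizer_iff]
  rintro _ (⟨a, b, s, -, rfl⟩ | ⟨a, b, s, rfl⟩)
  · exact elemAct_mul_smashToEnd a b s c
  · refine LinearMap.ext fun x => ?_
    have ha := LinearMap.congr_fun (elemAct_mul_smashToEnd a a s c) x
    have hb := LinearMap.congr_fun (elemAct_mul_smashToEnd b b s c) x
    simp only [Module.End.mul_apply] at ha hb
    simp only [Module.End.mul_apply, LinearMap.sub_apply, map_sub, ha, hb]

theorem smashWord_baseWord_injective (h : n < m) :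
    Function.Injective fun p => smashWord m n p (baseWord m n h) := by
  rintro ⟨a, σ⟩ ⟨b, τ⟩ hab
  have hi := fun i => congrFun hab i
  simp only [smashWord, baseWord, Prod.mk.injEq, add_zero, Fin.castLE_inj] at hi
  exact Prod.ext (Finsupp.ext fun i => (hi i).2)
    (inv_injective (Equiv.ext fun i => (hi i).1))

theorem smashToEnd_injective (h : n < m) : Function.Injective (smashToEnd m n) := by
  intro c d hcd
  apply Finsupp.mapDomain_injective (smashWord_baseWord_injective h)
  rw [← smashToEnd_apply_single, ← smashToEnd_apply_single, hcd]

/-- `E_{aa}` acts diagonally, its eigenvalue being the number of letters equal to `a`. -/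
theorem elemAct_self_zero_apply (a : Fin m) (F : TPow m n) (w : Fin n → Fin m × ℕ) :
    elemAct m n a a 0 F w = (Finset.univ.filter fun i => (w i).1 = a).card * F w := by
  induction F using Finsupp.induction_linear with
  | zero => simp
  | add F G hF hG => rw [map_add, Finsupp.add_apply, hF, hG, Finsupp.add_apply, mul_add]
  | single u x =>
    have hu : ∀ i : Fin n, (if (u i).1 = a then
        Finsupp.single (Function.update u i (a, (u i).2 + 0)) (1 : ℂ) else 0) =
        if (u i).1 = a then Finsupp.single u (1 : ℂ) else 0 := by
      intro i
      split_ifs with hi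
      · have : (a, (u i).2 + 0) = u i := Prod.ext hi.symm rfl
        rw [this, Function.update_eq_self]
      · rfl
    rw [elemAct_single, Finset.sum_congr rfl fun i _ => hu i, ← Finset.sum_filter,
      Finset.sum_const]
    by_cases huw : u = w
    · subst huw
      simp [mul_comm]
    · simp [Finsupp.single_eq_of_ne' huw]

/-- Elements of the commutant preserve the weight of `v₁ ⊗ ⋯ ⊗ vₙ`. -/
theorem exists_smashWord_eq_of_mem_slEndo (h : n < m) {f : Module.End ℂ (TPow m n)}
    (hf : f ∈ slEndo m n) {w : Fin n → Fin m × ℕ}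
    (hw : f (Finsupp.single (baseWord m n h) 1) w ≠ 0) :
    ∃ p, smashWord m n p (baseWord m n h) = w := by
  rw [slEndo, Subalgebra.mem_centralizer_iff] at hf
  have hex : ∀ k : Fin n, ∃ i, (w i).1 = Fin.castLE h.le k := by
    intro k
    have hcomm := congrArg (fun g => g (Finsupp.single (baseWord m n h) 1) w)
      (hf _ (Or.inr ⟨Fin.castLE h.le k, ⟨n, h⟩, 0, rfl⟩))
    have hbase : elemAct m n (Fin.castLE h.le k) (Fin.castLE h.le k) 0
          (Finsupp.single (baseWord m n h) 1) -
        elemAct m n ⟨n, h⟩ ⟨n, h⟩ 0 (Finsupp.single (baseWord m n h) 1) =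
          Finsupp.single (baseWord m n h) 1 := by
      ext u
      rw [Finsupp.sub_apply, elemAct_self_zero_apply, elemAct_self_zero_apply, ← sub_mul]
      by_cases hu : baseWord m n h = u
      · subst hu
        have h1 : (Finset.univ.filter fun i => (baseWord m n h i).1 = Fin.castLE h.le k) =
            {k} := by
          ext i; simp [baseWord]
        have h2 : (Finset.univ.filter fun i => (baseWord m n h i).1 = ⟨n, h⟩) = ∅ := by
          ext i; simp [baseWord, Fin.ext_iff, i.isLt.ne]
        rw [h1, h2]
        simp
      · simp [Finsupp.single_eq_of_ne' hu]
    simp only [Module.End.mul_apply, LinearMap.sub_apply] at hcomm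
    rw [hbase, Finsupp.sub_apply, elemAct_self_zero_apply, elemAct_self_zero_apply,
      ← sub_mul] at hcomm
    have hcard := mul_right_cancel₀ hw (hcomm.trans (one_mul _).symm)
    by_contra! hne
    rw [Finset.filter_false_of_mem fun i _ => hne i] at hcard
    rw [sub_eq_iff_eq_add] at hcard
    norm_cast at hcard
    simp at hcard
    omega
  choose τ hτ using hex
  have hinj : Function.Injective τ := by
    intro i j hij
    have := (hτ i).symm.trans ((congrArg (fun k => (w k).1) hij).trans (hτ j))
    simpa using this
  let σ : Equiv.Perm (Fin n) := Equiv.ofBijective τ (Finite.injective_iff_bijective.mp hinj)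
  refine ⟨(Finsupp.equivFunOnFinite.symm fun i => (w i).2, σ), ?_⟩
  funext i
  refine Prod.ext ?_ (by simp [smashWord, baseWord])
  have hi : τ (σ⁻¹ i) = i := σ.apply_symm_apply i
  have := hτ (σ⁻¹ i)
  rw [hi] at this
  exact this.symm

theorem exists_smashToEnd_apply_eq (h : n < m) {f : Module.End ℂ (TPow m n)}
    (hf : f ∈ slEndo m n) :
    ∃ c, smashToEnd m n c (Finsupp.single (baseWord m n h) 1) =
      f (Finsupp.single (baseWord m n h) 1) := by
  have hinj := smashWord_baseWord_injective (m := m) (n := n) h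
  refine ⟨Finsupp.comapDomain _ (f (Finsupp.single (baseWord m n h) 1)) hinj.injOn, ?_⟩
  rw [smashToEnd_apply_single]
  refine Finsupp.mapDomain_comapDomain _ hinj _ fun w hw => ?_
  exact exists_smashWord_eq_of_mem_slEndo h hf (Finsupp.mem_support_iff.mp hw)

/-- An element of the commutant that kills `baseWord` kills all words that agree with it from
the place `k` on. In the inductive step, `E_{xk} t^s` applied to a word agreeing with `baseWord`
from `k` on changes the `k`-th place to `x t^s`, up to words that still agree from `k` on; if
`x = k`, use `(E_{kk} - E_{nn}) t^s` instead, `n` being a letter that `baseWord` omits. -/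
theorem apply_single_eq_zero_of_agree (h : n < m) {f : Module.End ℂ (TPow m n)}
    (hf : f ∈ slEndo m n) (hbase : f (Finsupp.single (baseWord m n h) 1) = 0) (k : ℕ)
    (w : Fin n → Fin m × ℕ) (hw : ∀ i : Fin n, k ≤ i → w i = baseWord m n h i) :
    f (Finsupp.single w 1) = 0 := by
  rw [slEndo, Subalgebra.mem_centralizer_iff] at hf
  induction k generalizing w with
  | zero => rwa [funext fun i => hw i (Nat.zero_le _)]
  | succ k ih =>
    rcases le_or_gt n k with hnk | hkn
    · exact ih w fun i hi => absurd i.isLt (by omega)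
    let l : Fin n := ⟨k, hkn⟩
    let u := Function.update w l (baseWord m n h l)
    have hu : ∀ i : Fin n, k ≤ i → u i = baseWord m n h i := by
      intro i hi
      by_cases hil : i = l
      · rw [hil]; exact Function.update_self ..
      · rw [show u i = w i from Function.update_of_ne hil ..]
        exact hw i (by have : (i : ℕ) ≠ k := fun e => hil (Fin.ext e)
                       omega)
    have hsmall : ∀ i : Fin n, i < l → ∀ z, f (Finsupp.single (Function.update u i z) 1) = 0 := by
      intro i hi z
      refine ih _ fun j hj => ?_
      have hji : j ≠ i := by rintro rfl; exact absurd hi (not_lt.mpr hj)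
      rw [Function.update_of_ne hji, hu j hj]
    have hact : f (elemAct m n (w l).1 (Fin.castLE h.le l) (w l).2 (Finsupp.single u 1)) =
        f (Finsupp.single w 1) := by
      rw [elemAct_single, one_smul, map_sum, Finset.sum_eq_single l]
      · have hul : u l = (Fin.castLE h.le l, 0) := hu l le_rfl
        rw [hul, if_pos rfl, zero_add, Prod.mk.eta]
        simp [u]
      · intro i _ hil
        rcases lt_or_gt_of_ne hil with hlt | hgt
        · split_ifs
          · exact hsmall i hlt _
          · simp
        · rw [hu i (le_of_lt hgt), if_neg, map_zero]
          simpa [baseWord] using hil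
      · simp
    have hextra : ∀ s, f (elemAct m n ⟨n, h⟩ ⟨n, h⟩ s (Finsupp.single u 1)) = 0 := by
      intro s
      rw [elemAct_single, one_smul, map_sum]
      refine Finset.sum_eq_zero fun i _ => ?_
      rcases lt_or_ge i l with hlt | hge
      · split_ifs
        · exact hsmall i hlt _
        · simp
      · rw [hu i hge, if_neg, map_zero]
        simp [baseWord, Fin.ext_iff, i.isLt.ne]
    rw [← hact]
    by_cases hne : (w l).1 = Fin.castLE h.le l
    · have hcomm := LinearMap.congr_fun
        (hf _ (Or.inr ⟨Fin.castLE h.le l, ⟨n, h⟩, (w l).2, rfl⟩)) (Finsupp.single u 1)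
      rw [Module.End.mul_apply, Module.End.mul_apply, ih u hu, map_zero, LinearMap.sub_apply,
        map_sub, hextra, sub_zero] at hcomm
      rw [hne]
      exact hcomm.symm
    · have hcomm := LinearMap.congr_fun
        (hf _ (Or.inl ⟨_, _, (w l).2, hne, rfl⟩)) (Finsupp.single u 1)
      rw [Module.End.mul_apply, Module.End.mul_apply, ih u hu, map_zero] at hcomm
      exact hcomm.symm

/-- The vector `v₁ ⊗ ⋯ ⊗ vₙ` generates `V[t]^{⊗n}` over `𝔰𝔩_V[t]`. -/
theorem eq_zero_of_apply_baseWord (h : n < m) {f : Module.End ℂ (TPow m n)}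
    (hf : f ∈ slEndo m n) (hbase : f (Finsupp.single (baseWord m n h) 1) = 0) : f = 0 := by
  refine Finsupp.lhom_ext' fun w => LinearMap.ext_ring ?_
  exact apply_single_eq_zero_of_agree h hf hbase n w fun i hi => absurd i.isLt (not_lt.mpr hi)

theorem range_smashToEnd (h : n < m) :
    Set.range (smashToEnd m n) = (slEndo m n : Set (Module.End ℂ (TPow m n))) := by
  ext f
  rw [SetLike.mem_coe, Set.mem_range]
  constructor
  · rintro ⟨c, rfl⟩
    exact smashToEnd_mem_slEndo c
  · intro hf
    obtain ⟨c, hc⟩ := exists_smashToEnd_apply_eq h hf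
    have hmem : smashToEnd m n (-c) + f ∈ slEndo m n :=
      add_mem (smashToEnd_mem_slEndo (-c)) hf
    have hzero : (smashToEnd m n (-c) + f) (Finsupp.single (baseWord m n h) 1) = 0 := by
      rw [LinearMap.add_apply, map_neg, LinearMap.neg_apply, hc, neg_add_cancel]
    have hsum := eq_zero_of_apply_baseWord h hmem hzero
    rw [map_neg, neg_add_eq_zero] at hsum
    exact ⟨c, hsum⟩

theorem smashToEnd_single_zero_one : smashToEnd m n (Finsupp.single (0, 1) 1) = 1 := by
  refine Finsupp.lhom_ext' fun w => LinearMap.ext_ring ?_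
  rw [smashToEnd_single, one_smul, LinearMap.comp_apply, Finsupp.lsingle_apply, smashOp_single]
  have : smashWord m n (0, 1) w = w := by funext i; simp [smashWord]
  rw [this]
  rfl

theorem smashToEnd_single_mul (a b : Fin n →₀ ℕ) (σ τ : Equiv.Perm (Fin n)) :
    smashToEnd m n (Finsupp.single (a + Finsupp.mapDomain σ b, σ * τ) 1) =
      smashToEnd m n (Finsupp.single (a, σ) 1) *
        smashToEnd m n (Finsupp.single (b, τ) 1) := by
  refine Finsupp.lhom_ext' fun w => LinearMap.ext_ring ?_
  simp only [smashToEnd_single, one_smul, LinearMap.comp_apply, Finsupp.lsingle_apply,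
    Module.End.mul_apply, smashOp_single]
  congr 1
  funext i
  obtain ⟨j, rfl⟩ := σ.surjective i
  simp [smashWord, Finsupp.mapDomain_apply σ.injective, add_assoc]

variable (m n)

/-- For `m > n`, `ψ` is an algebra isomorphism
`ℂ[𝔖_n] ⋉ ℂ[t₁,…,tₙ] ≃ End_{𝔰𝔩_V[t]}(V[t]^{⊗n})`:
it is injective, its image is exactly the commutant of `𝔰𝔩_m[t]`, it sends the unit to
the identity, and it transforms the smash-product multiplication
`(t^a σ)(t^b τ) = t^{a + σ·b}(στ)` into composition of endomorphisms. -/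
theorem smash_product_iso_slEndomorphisms (hmn : n < m) :
    Function.Injective (smashToEnd m n) ∧
    Set.range (smashToEnd m n) = (slEndo m n : Set (Module.End ℂ (TPow m n))) ∧
    smashToEnd m n (Finsupp.single (0, 1) 1) = 1 ∧
    (∀ (a b : Fin n →₀ ℕ) (σ τ : Equiv.Perm (Fin n)),
      smashToEnd m n (Finsupp.single (a + Finsupp.mapDomain σ b, σ * τ) 1) =
        smashToEnd m n (Finsupp.single (a, σ) 1) *
          smashToEnd m n (Finsupp.single (b, τ) 1)) := by
  exact ⟨smashToEnd_injective hmn, range_smashToEnd hmn, smashToEnd_single_zero_one,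
    smashToEnd_single_mul⟩

end
end
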